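/- arXiv:2410.04943 — 9 statements merged into one kernel-verified Lean document; each statement's English description precedes it below -/
import Mathlib

section
/- In the abstract Hilbert-space setting of the localized a posteriori estimates, for every v ∈ H one has the dual-norm localization inequality ‖v‖_{A⁻¹} ≤ C^{1/2} · ( Σ_{k=1}^{K+1} ‖T_k v‖_{A_k⁻¹}² )^{1/2}. (This is Lemma 5.2 of the paper.) -/
open scoped RealInnerProductSpace

/-- Weighted Young inequality for a symmetric positive operator `A`:
`2 s ⟪A u, x⟫ ≤ s² ⟪A u, u⟫ + ⟪x, A x⟫`. -/
theorem two_mul_inner_le_of_symm_of_nonneg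
    {E : Type*} [NormedAddCommGroup E] [InnerProductSpace ℝ E] (A : E →L[ℝ] E)
    (hsym : ∀ v w : E, ⟪A v, w⟫ = ⟪v, A w⟫) (hpos : ∀ w : E, 0 ≤ ⟪w, A w⟫) (s : ℝ) (u x : E) :
    2 * s * ⟪A u, x⟫ ≤ s ^ 2 * ⟪A u, u⟫ + ⟪x, A x⟫ := by
  have h := hpos (x - s • u)
  simp only [map_sub, map_smul, inner_sub_left, inner_sub_right, real_inner_smul_left,
    real_inner_smul_right] at h
  rw [← hsym u x, ← hsym u u, real_inner_comm (A u) x] at h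
  linarith

/-- Lemma 5.2: localized dual-norm inequality
`‖v‖_{A⁻¹} ≤ C^{1/2} (∑_{k=1}^{K+1} ‖T_k v‖_{A_k⁻¹}²)^{1/2}`. -/
theorem dual_norm_localization
    {H : Type*} [NormedAddCommGroup H] [InnerProductSpace ℝ H] [CompleteSpace H]
    {K : ℕ} (hK : 1 ≤ K)
    {Hk : Fin (K + 1) → Type*} [∀ k, NormedAddCommGroup (Hk k)]
    [∀ k, InnerProductSpace ℝ (Hk k)] [∀ k, CompleteSpace (Hk k)]
    (A B : H →L[ℝ] H)
    (hAsym : ∀ v w : H, ⟪A v, w⟫ = ⟪v, A w⟫)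
    (hApos : ∀ w : H, 0 ≤ ⟪w, A w⟫)
    (hAB : ∀ v, A (B v) = v) (hBA : ∀ v, B (A v) = v)
    (Ak Bk : ∀ k, Hk k →L[ℝ] Hk k)
    (hAksym : ∀ k, ∀ v w : Hk k, ⟪Ak k v, w⟫ = ⟪v, Ak k w⟫)
    (hAkpos : ∀ k, ∀ w : Hk k, 0 ≤ ⟪w, Ak k w⟫)
    (hAkBk : ∀ k, ∀ v : Hk k, Ak k (Bk k v) = v)
    (hBkAk : ∀ k, ∀ v : Hk k, Bk k (Ak k v) = v)
    (T : ∀ k, H →L[ℝ] Hk k)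
    (hT : ∀ v w : H, ⟪v, w⟫ = ∑ k, ⟪T k v, T k w⟫)
    (C : ℝ) (hC : 0 < C)
    (hCbound : ∀ w : H, ∑ k, ⟪T k w, Ak k (T k w)⟫ ≤ C * ⟪w, A w⟫)
    (v : H) :
    Real.sqrt ⟪v, B v⟫ ≤
      Real.sqrt C * Real.sqrt (∑ k, ⟪T k v, Bk k (T k v)⟫) := by
  rw [← Real.sqrt_mul hC.le]
  apply Real.sqrt_le_sqrt
  have hlocal : ∀ k, 2 * C * ⟪T k v, T k (B v)⟫ ≤
      C ^ 2 * ⟪T k v, Bk k (T k v)⟫ + ⟪T k (B v), Ak k (T k (B v))⟫ := fun k => by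
    simpa only [hAkBk] using two_mul_inner_le_of_symm_of_nonneg (Ak k) (hAksym k) (hAkpos k) C
      (Bk k (T k v)) (T k (B v))
  have hsum := Finset.sum_le_sum fun k (_ : k ∈ Finset.univ) => hlocal k
  rw [← Finset.mul_sum, Finset.sum_add_distrib, ← Finset.mul_sum, ← hT] at hsum
  have hbound := hCbound (B v)
  rw [hAB, real_inner_comm] at hbound
  refine le_of_mul_le_mul_left ?_ hC
  linarith
end

section
/- In the abstract Hilbert-space setting of the localized a posteriori estimates, let f ∈ H, let u ∈ H solve the source problem A u = f, and let u_N ∈ H be an arbitrary approximate solution; set Res(u_N) := f − A u_N. Then the energy norm of the error is bounded by the localized dual norms of the residual: ‖u − u_N‖_A ≤ C^{1/2} · ( Σ_{k=1}^{K+1} ‖T_k Res(u_N)‖_{A_k⁻¹}² )^{1/2}. (This is Theorem 3.1 of the paper, the A-error estimation for the source problem.) -/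
open scoped RealInnerProductSpace

/-- Young's inequality for the duality between the energy form of a symmetric positive operator `A`
and the form of its right inverse `B`. -/
theorem two_mul_inner_le_energy_add_dual {E : Type*} [NormedAddCommGroup E]
    [InnerProductSpace ℝ E] (A B : E →L[ℝ] E)
    (hsym : ∀ v w : E, ⟪A v, w⟫ = ⟪v, A w⟫) (hpos : ∀ w : E, 0 ≤ ⟪w, A w⟫)
    (hAB : ∀ v, A (B v) = v) (w r : E) (s : ℝ) :
    2 * s * ⟪w, r⟫ ≤ ⟪w, A w⟫ + s ^ 2 * ⟪r, B r⟫ := by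
  have h := hpos (w - s • B r)
  have hcross : ⟪B r, A w⟫ = ⟪w, r⟫ := by rw [← hsym, hAB, real_inner_comm]
  simp only [map_sub, map_smul, hAB, inner_sub_left, inner_sub_right, real_inner_smul_left,
    real_inner_smul_right, hcross] at h
  rw [real_inner_comm r (B r)] at h
  linarith

/-- Theorem 3.1: A-error estimation for the source problem:
`‖u − u_N‖_A ≤ C^{1/2} (∑_{k=1}^{K+1} ‖T_k Res(u_N)‖_{A_k⁻¹}²)^{1/2}`
with `Res(u_N) = f − A u_N` and `A u = f`. -/
theorem source_problem_energy_error_estimate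
    {H : Type*} [NormedAddCommGroup H] [InnerProductSpace ℝ H] [CompleteSpace H]
    {K : ℕ} (hK : 1 ≤ K)
    {Hk : Fin (K + 1) → Type*} [∀ k, NormedAddCommGroup (Hk k)]
    [∀ k, InnerProductSpace ℝ (Hk k)] [∀ k, CompleteSpace (Hk k)]
    (A B : H →L[ℝ] H)
    (hAsym : ∀ v w : H, ⟪A v, w⟫ = ⟪v, A w⟫)
    (hApos : ∀ w : H, 0 ≤ ⟪w, A w⟫)
    (hAB : ∀ v, A (B v) = v) (hBA : ∀ v, B (A v) = v)
    (Ak Bk : ∀ k, Hk k →L[ℝ] Hk k)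
    (hAksym : ∀ k, ∀ v w : Hk k, ⟪Ak k v, w⟫ = ⟪v, Ak k w⟫)
    (hAkpos : ∀ k, ∀ w : Hk k, 0 ≤ ⟪w, Ak k w⟫)
    (hAkBk : ∀ k, ∀ v : Hk k, Ak k (Bk k v) = v)
    (hBkAk : ∀ k, ∀ v : Hk k, Bk k (Ak k v) = v)
    (T : ∀ k, H →L[ℝ] Hk k)
    (hT : ∀ v w : H, ⟪v, w⟫ = ∑ k, ⟪T k v, T k w⟫)
    (C : ℝ) (hC : 0 < C)
    (hCbound : ∀ w : H, ∑ k, ⟪T k w, Ak k (T k w)⟫ ≤ C * ⟪w, A w⟫)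
    (f u uN : H) (hu : A u = f) (Res : H) (hRes : Res = f - A uN) :
    Real.sqrt ⟪u - uN, A (u - uN)⟫ ≤
      Real.sqrt C * Real.sqrt (∑ k, ⟪T k Res, Bk k (T k Res)⟫) := by
  have hres : A (u - uN) = Res := by rw [map_sub, hu, hRes]
  have henergy : ⟪u - uN, A (u - uN)⟫ = ∑ k, ⟪T k (u - uN), T k Res⟫ := by rw [hres, hT]
  have hyoung : 2 * C * ∑ k, ⟪T k (u - uN), T k Res⟫ ≤
      ∑ k, ⟪T k (u - uN), Ak k (T k (u - uN))⟫ + C ^ 2 * ∑ k, ⟪T k Res, Bk k (T k Res)⟫ := by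
    rw [Finset.mul_sum, Finset.mul_sum, ← Finset.sum_add_distrib]
    exact Finset.sum_le_sum fun k _ => two_mul_inner_le_energy_add_dual (Ak k) (Bk k) (hAksym k)
      (hAkpos k) (hAkBk k) _ _ C
  rw [← henergy] at hyoung
  rw [← Real.sqrt_mul hC.le]
  refine Real.sqrt_le_sqrt (le_of_mul_le_mul_left ?_ hC)
  linarith [hCbound (u - uN)]
end

section
/- In the abstract eigenvalue setting, the energy-norm error satisfies ‖φ − φ_N‖_A² − (λ/4) · ‖φ − φ_N‖⁴ ≤ γ⁻¹ · ‖Res‖_{A⁻¹}². (This is the A-error estimation (5.3) of Proposition 5.3 of the paper.) -/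
open scoped RealInnerProductSpace

/-- Proposition 5.3, estimate (5.3): ‖φ − φ_N‖_A² − (λ/4)‖φ − φ_N‖⁴ ≤ γ⁻¹ ‖Res‖_{A⁻¹}². -/
theorem eigenvector_energy_error_estimate
    {H : Type*} [NormedAddCommGroup H] [InnerProductSpace ℝ H] [CompleteSpace H]
    (A B : H →L[ℝ] H)
    (hAsym : ∀ v w : H, ⟪A v, w⟫ = ⟪v, A w⟫)
    (hApos : ∀ w : H, 0 ≤ ⟪w, A w⟫)
    (hAB : ∀ v, A (B v) = v) (hBA : ∀ v, B (A v) = v)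
    (lam : ℝ) (φ : H) (hφ : A φ = lam • φ) (hφnorm : ‖φ‖ = 1)
    (lamN : ℝ) (φN : H) (hφNnorm : ‖φN‖ = 1)
    (Res : H) (hRes : Res = lamN • φN - A φN)
    (γ γhat : ℝ) (hγ : 0 < γ) (hγhat : 0 < γhat)
    (hgap1 : ∀ w : H, ⟪w, φ⟫ = 0 →
      γ * ⟪w, A w⟫ ≤ ⟪A w - lamN • w, B (A w - lamN • w)⟫)
    (hgap2 : ∀ w : H, ⟪w, φ⟫ = 0 →
      γhat * ‖w‖ ^ 2 ≤ ⟪A w - lamN • w, B (A w - lamN • w)⟫) :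
    ⟪φ - φN, A (φ - φN)⟫ - (lam / 4) * ‖φ - φN‖ ^ 4 ≤ γ⁻¹ * ⟪Res, B Res⟫ := by
  have hφφ : ⟪φ, φ⟫ = 1 := by simp [hφnorm]
  have hNN : ⟪φN, φN⟫ = 1 := by simp [hφNnorm]
  have hlam : lam ≠ 0 := by
    rintro rfl
    have h : φ = 0 := by rw [← hBA φ, hφ]; simp
    simp [h] at hφnorm
  have hBφ : B φ = lam⁻¹ • φ := by
    have h := hBA φ
    rw [hφ, map_smul] at h
    rw [← h, smul_smul, inv_mul_cancel₀ hlam, one_smul, h]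
  have hlampos : 0 ≤ lam⁻¹ := by
    have h := hApos φ
    rw [hφ, inner_smul_right, hφφ, mul_one] at h
    exact inv_nonneg.2 h
  obtain ⟨c, hc⟩ : ∃ c : ℝ, c = ⟪φN, φ⟫ := ⟨_, rfl⟩
  obtain ⟨w, hw⟩ : ∃ w : H, w = φN - c • φ := ⟨_, rfl⟩
  have hφN : φN = w + c • φ := by rw [hw]; abel
  have hwφ : ⟪w, φ⟫ = 0 := by
    rw [hw, inner_sub_left, inner_smul_left, hφφ, ← hc]; simp
  have hφw : ⟪φ, w⟫ = 0 := by rw [real_inner_comm, hwφ]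
  have hφAw : ⟪φ, A w⟫ = 0 := by
    rw [← hAsym, hφ, inner_smul_left, hφw, mul_zero]
  have hsq : ‖φ - φN‖ ^ 2 = 2 - 2 * c := by
    rw [norm_sub_sq_real, hφnorm, hφNnorm, real_inner_comm, ← hc]; ring
  have henergy : ⟪φ - φN, A (φ - φN)⟫ = (1 - c) ^ 2 * lam + ⟪w, A w⟫ := by
    have h : φ - φN = (1 - c) • φ - w := by rw [hφN]; module
    rw [h, map_sub, map_smul, hφ]
    simp only [inner_sub_left, inner_sub_right, inner_smul_left, inner_smul_right, hφφ, hwφ, hφAw,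
      conj_trivial]
    ring
  obtain ⟨u, hu⟩ : ∃ u : H, u = A w - lamN • w := ⟨_, rfl⟩
  have huφ : ⟪u, φ⟫ = 0 := by
    rw [hu, inner_sub_left, inner_smul_left, hwφ, real_inner_comm, hφAw]; simp
  have hφBu : ⟪φ, B u⟫ = 0 := by
    have h : ⟪A φ, B u⟫ = 0 := by rw [hAsym, hAB, real_inner_comm, huφ]
    rw [hφ, inner_smul_left] at h
    exact (mul_eq_zero.1 h).resolve_left hlam
  have hdual : ⟪Res, B Res⟫ = ⟪u, B u⟫ + (c * (lamN - lam)) ^ 2 * lam⁻¹ := by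
    have h : Res = (c * (lamN - lam)) • φ - u := by
      rw [hRes, hu, hφN, map_add, map_smul, hφ]; module
    rw [h, map_sub, map_smul, hBφ]
    simp only [inner_sub_left, inner_sub_right, inner_smul_left, inner_smul_right, hφφ, huφ, hφBu,
      conj_trivial]
    ring
  have hgap := hgap1 w hwφ
  rw [← hu] at hgap
  have hlhs : ⟪φ - φN, A (φ - φN)⟫ - (lam / 4) * ‖φ - φN‖ ^ 4 = ⟪w, A w⟫ := by
    rw [henergy, show ‖φ - φN‖ ^ 4 = (‖φ - φN‖ ^ 2) ^ 2 by ring, hsq]; ring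
  rw [hlhs, le_inv_mul_iff₀ hγ, hdual]
  have hnonneg : 0 ≤ (c * (lamN - lam)) ^ 2 * lam⁻¹ := by positivity
  linarith
end

section
/- In the abstract eigenvalue setting, the L²-norm error satisfies ‖φ − φ_N‖² − (1/4) · ‖φ − φ_N‖⁴ ≤ γ̂⁻¹ · ‖Res‖_{A⁻¹}². (This is the L²-error estimation (5.4) of Proposition 5.3 of the paper.) -/
open scoped RealInnerProductSpace

/-- Proposition 5.3, estimate (5.4): ‖φ − φ_N‖² − (1/4)‖φ − φ_N‖⁴ ≤ γ̂⁻¹ ‖Res‖_{A⁻¹}². -/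
theorem eigenvector_L2_error_estimate
    {H : Type*} [NormedAddCommGroup H] [InnerProductSpace ℝ H] [CompleteSpace H]
    (A B : H →L[ℝ] H)
    (hAsym : ∀ v w : H, ⟪A v, w⟫ = ⟪v, A w⟫)
    (hApos : ∀ w : H, 0 ≤ ⟪w, A w⟫)
    (hAB : ∀ v, A (B v) = v) (hBA : ∀ v, B (A v) = v)
    (lam : ℝ) (φ : H) (hφ : A φ = lam • φ) (hφnorm : ‖φ‖ = 1)
    (lamN : ℝ) (φN : H) (hφNnorm : ‖φN‖ = 1)
    (Res : H) (hRes : Res = lamN • φN - A φN)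
    (γ γhat : ℝ) (hγ : 0 < γ) (hγhat : 0 < γhat)
    (hgap1 : ∀ w : H, ⟪w, φ⟫ = 0 →
      γ * ⟪w, A w⟫ ≤ ⟪A w - lamN • w, B (A w - lamN • w)⟫)
    (hgap2 : ∀ w : H, ⟪w, φ⟫ = 0 →
      γhat * ‖w‖ ^ 2 ≤ ⟪A w - lamN • w, B (A w - lamN • w)⟫) :
    ‖φ - φN‖ ^ 2 - (1 / 4) * ‖φ - φN‖ ^ 4 ≤ γhat⁻¹ * ⟪Res, B Res⟫ := by
  have hlam : lam ≠ 0 := by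
    rintro rfl
    have h := hBA φ
    rw [hφ, zero_smul, map_zero] at h
    simp [← h] at hφnorm
  have hφφ : ⟪φ, φ⟫ = 1 := by rw [real_inner_self_eq_norm_sq, hφnorm, one_pow]
  obtain ⟨c, hc⟩ : ∃ c, c = ⟪φ, φN⟫ := ⟨_, rfl⟩
  obtain ⟨w, hw⟩ : ∃ w, w = φN - c • φ := ⟨_, rfl⟩
  obtain ⟨u, hu⟩ : ∃ u, u = A w - lamN • w := ⟨_, rfl⟩
  have hwφ : ⟪w, φ⟫ = 0 := by
    rw [hw, inner_sub_left, real_inner_smul_left, hφφ, real_inner_comm, hc]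
    ring
  have hwnorm : ‖w‖ ^ 2 = 1 - c ^ 2 := by
    rw [hw, norm_sub_sq_real, norm_smul, hφnorm, hφNnorm, real_inner_smul_right,
      real_inner_comm, ← hc, Real.norm_eq_abs, mul_one, sq_abs]
    ring
  have huφ : ⟪u, φ⟫ = 0 := by
    rw [hu, inner_sub_left, hAsym, hφ, real_inner_smul_left, real_inner_smul_right, hwφ]
    ring
  have hBφ : lam • B φ = φ := by rw [← map_smul, ← hφ, hBA]
  have huBφ : ⟪u, B φ⟫ = 0 := by
    rw [← hBφ, real_inner_smul_right] at huφ
    exact (mul_eq_zero.mp huφ).resolve_left hlam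
  have hφBu : ⟪φ, B u⟫ = 0 := by
    rw [← hAB φ, hAsym, hAB, real_inner_comm, huBφ]
  have hφBφ : 0 ≤ ⟪φ, B φ⟫ := by
    have h := hApos (B φ)
    rwa [hAB, real_inner_comm] at h
  have hRes' : Res = (c * (lamN - lam)) • φ - u := by
    rw [hRes, hu, hw, map_sub, map_smul, hφ]
    module
  have hle : ⟪u, B u⟫ ≤ ⟪Res, B Res⟫ := by
    have h : ⟪Res, B Res⟫ = (c * (lamN - lam)) ^ 2 * ⟪φ, B φ⟫ + ⟪u, B u⟫ := by
      rw [hRes', map_sub, map_smul]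
      simp only [inner_sub_left, inner_sub_right, real_inner_smul_left, real_inner_smul_right,
        huBφ, hφBu]
      ring
    rw [h]
    exact le_add_of_nonneg_left (by positivity)
  have hdiff : ‖φ - φN‖ ^ 2 = 2 - 2 * c := by
    rw [norm_sub_sq_real, hφnorm, hφNnorm, ← hc]
    ring
  have hgap := hgap2 w hwφ
  rw [← hu, hwnorm] at hgap
  have hlhs : ‖φ - φN‖ ^ 2 - (1 / 4) * ‖φ - φN‖ ^ 4 = 1 - c ^ 2 := by
    linear_combination (1 - (1 / 4) * (‖φ - φN‖ ^ 2 + (2 - 2 * c))) * hdiff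
  rw [hlhs, le_inv_mul_iff₀ hγhat]
  exact hgap.trans hle
end

section
/- In the abstract eigenvalue setting, if in addition ⟨φ, φ_N⟩ ≥ 0, then the L²-norm error is controlled by the dual norm of the residual: ‖φ − φ_N‖ ≤ (2 / γ̂)^{1/2} · ‖Res‖_{A⁻¹}. (This is Lemma 5.4 of the paper.) -/
open scoped RealInnerProductSpace

/-- For unit vectors with nonnegative inner product, the distance is controlled by the component of
one vector orthogonal to the other. -/
theorem norm_sub_sq_le_two_mul_norm_sub_inner_smul_sq
    {H : Type*} [NormedAddCommGroup H] [InnerProductSpace ℝ H] {x y : H}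
    (hx : ‖x‖ = 1) (hy : ‖y‖ = 1) (hxy : 0 ≤ ⟪x, y⟫) :
    ‖x - y‖ ^ 2 ≤ 2 * ‖y - ⟪x, y⟫ • x‖ ^ 2 := by
  have hle : ⟪x, y⟫ ≤ 1 := by simpa [hx, hy] using real_inner_le_norm x y
  rw [norm_sub_sq_real, norm_sub_sq_real, norm_smul, inner_smul_right, real_inner_comm x y, hx, hy,
    Real.norm_of_nonneg hxy]
  nlinarith

/-- Lemma 5.4: if ⟨φ, φ_N⟩ ≥ 0 then ‖φ − φ_N‖ ≤ (2/γ̂)^{1/2} ‖Res‖_{A⁻¹}. -/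
theorem eigenvector_L2_error_bound
    {H : Type*} [NormedAddCommGroup H] [InnerProductSpace ℝ H] [CompleteSpace H]
    (A B : H →L[ℝ] H)
    (hAsym : ∀ v w : H, ⟪A v, w⟫ = ⟪v, A w⟫)
    (hApos : ∀ w : H, 0 ≤ ⟪w, A w⟫)
    (hAB : ∀ v, A (B v) = v) (hBA : ∀ v, B (A v) = v)
    (lam : ℝ) (φ : H) (hφ : A φ = lam • φ) (hφnorm : ‖φ‖ = 1)
    (lamN : ℝ) (φN : H) (hφNnorm : ‖φN‖ = 1)
    (Res : H) (hRes : Res = lamN • φN - A φN)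
    (γ γhat : ℝ) (hγ : 0 < γ) (hγhat : 0 < γhat)
    (hgap1 : ∀ w : H, ⟪w, φ⟫ = 0 →
      γ * ⟪w, A w⟫ ≤ ⟪A w - lamN • w, B (A w - lamN • w)⟫)
    (hgap2 : ∀ w : H, ⟪w, φ⟫ = 0 →
      γhat * ‖w‖ ^ 2 ≤ ⟪A w - lamN • w, B (A w - lamN • w)⟫)
    (hposip : 0 ≤ ⟪φ, φN⟫) :
    ‖φ - φN‖ ≤ Real.sqrt (2 / γhat) * Real.sqrt ⟪Res, B Res⟫ := by
  set c : ℝ := ⟪φ, φN⟫ with hc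
  set w : H := φN - c • φ with hw
  set r : H := A w - lamN • w with hr
  have hwφ : ⟪w, φ⟫ = 0 := by
    rw [hw, inner_sub_left, real_inner_smul_left, real_inner_self_eq_norm_sq, hφnorm,
      real_inner_comm, ← hc]
    ring
  have hlam : lam ≠ 0 := by
    rintro rfl
    have hφ_zero : φ = 0 := by rw [← hBA φ, hφ, zero_smul, map_zero]
    simp [hφ_zero] at hφnorm
  have hBφ : lam • B φ = φ := by rw [← map_smul, ← hφ, hBA]
  have hrφ : ⟪r, φ⟫ = 0 := by
    rw [hr, inner_sub_left, hAsym, hφ, real_inner_smul_right, real_inner_smul_left, hwφ]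
    ring
  have hrBφ : ⟪r, B φ⟫ = 0 := by
    have h : lam * ⟪r, B φ⟫ = 0 := by rw [← real_inner_smul_right, hBφ, hrφ]
    exact (mul_eq_zero.mp h).resolve_left hlam
  have hφBr : ⟪φ, B r⟫ = 0 := by
    have h : lam * ⟪φ, B r⟫ = 0 := by
      rw [← real_inner_smul_left, ← hφ, hAsym, hAB, real_inner_comm, hrφ]
    exact (mul_eq_zero.mp h).resolve_left hlam
  have hφBφ : 0 ≤ ⟪φ, B φ⟫ := by
    have h := hApos (B φ)
    rwa [hAB, real_inner_comm] at h
  have hRes_eq : Res = (c * (lamN - lam)) • φ - r := by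
    rw [hRes, hr, hw, map_sub, map_smul, hφ]
    module
  have hdual : ⟪r, B r⟫ ≤ ⟪Res, B Res⟫ := by
    rw [hRes_eq, map_sub B _ r, map_smul]
    simp only [inner_sub_left, inner_sub_right, real_inner_smul_left, real_inner_smul_right,
      hrBφ, hφBr]
    nlinarith [mul_nonneg (sq_nonneg (c * (lamN - lam))) hφBφ]
  have hsq := norm_sub_sq_le_two_mul_norm_sub_inner_smul_sq hφnorm hφNnorm hposip
  rw [← Real.sqrt_mul (by positivity)]
  apply Real.le_sqrt_of_sq_le
  rw [div_mul_eq_mul_div, le_div_iff₀ hγhat]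
  nlinarith [hgap2 w hwφ, mul_le_mul_of_nonneg_right hsq hγhat.le]
end

section
/- In the abstract eigenvalue setting, if in addition λ_N equals the Rayleigh quotient of the approximate eigenvector, λ_N = ⟨φ_N, A φ_N⟩, then the eigenvalue error satisfies λ_N − λ ≤ γ⁻¹ · ‖Res‖_{A⁻¹}². (This is Proposition 5.5 of the paper, the eigenvalue estimation.) -/
open scoped RealInnerProductSpace

/-- Proposition 5.5: if λ_N = ⟨φ_N, A φ_N⟩ then λ_N − λ ≤ γ⁻¹ ‖Res‖_{A⁻¹}². -/
theorem eigenvalue_error_estimate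
    {H : Type*} [NormedAddCommGroup H] [InnerProductSpace ℝ H] [CompleteSpace H]
    (A B : H →L[ℝ] H)
    (hAsym : ∀ v w : H, ⟪A v, w⟫ = ⟪v, A w⟫)
    (hApos : ∀ w : H, 0 ≤ ⟪w, A w⟫)
    (hAB : ∀ v, A (B v) = v) (hBA : ∀ v, B (A v) = v)
    (lam : ℝ) (φ : H) (hφ : A φ = lam • φ) (hφnorm : ‖φ‖ = 1)
    (lamN : ℝ) (φN : H) (hφNnorm : ‖φN‖ = 1)
    (Res : H) (hRes : Res = lamN • φN - A φN)
    (γ γhat : ℝ) (hγ : 0 < γ) (hγhat : 0 < γhat)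
    (hgap1 : ∀ w : H, ⟪w, φ⟫ = 0 →
      γ * ⟪w, A w⟫ ≤ ⟪A w - lamN • w, B (A w - lamN • w)⟫)
    (hgap2 : ∀ w : H, ⟪w, φ⟫ = 0 →
      γhat * ‖w‖ ^ 2 ≤ ⟪A w - lamN • w, B (A w - lamN • w)⟫)
    (hlamN : lamN = ⟪φN, A φN⟫) :
    lamN - lam ≤ γ⁻¹ * ⟪Res, B Res⟫ := by
  have hφφ : ⟪φ, φ⟫ = 1 := by rw [real_inner_self_eq_norm_sq, hφnorm]; norm_num
  have hlam_nonneg : 0 ≤ lam := by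
    have h := hApos φ
    rwa [hφ, inner_smul_right, hφφ, mul_one] at h
  have hlamB : lam • B φ = φ := by rw [← map_smul, ← hφ, hBA]
  have hlam_ne : lam ≠ 0 := by
    rintro rfl
    rw [zero_smul] at hlamB
    rw [← hlamB, inner_zero_left] at hφφ
    exact zero_ne_one hφφ
  have hBφ : B φ = lam⁻¹ • φ := by
    rw [eq_inv_smul_iff₀ hlam_ne, hlamB]
  -- Split `φN` into its component along `φ` and a remainder `w` orthogonal to `φ`.
  obtain ⟨c, w, hdecomp, hwφ⟩ : ∃ (c : ℝ) (w : H), φN = c • φ + w ∧ ⟪w, φ⟫ = 0 := by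
    refine ⟨⟪φN, φ⟫, φN - ⟪φN, φ⟫ • φ, by abel, ?_⟩
    rw [inner_sub_left, real_inner_smul_left, hφφ]
    ring
  have hφw : ⟪φ, w⟫ = 0 := by rw [real_inner_comm, hwφ]
  have hφAw : ⟪φ, A w⟫ = 0 := by rw [← hAsym, hφ, real_inner_smul_left, hφw, mul_zero]
  have hφBw : ⟪φ, B w⟫ = 0 := by
    have h := hAsym φ (B w)
    rw [hAB, hφ, real_inner_smul_left, hφw] at h
    exact (mul_eq_zero.mp h).resolve_left hlam_ne
  have hnorm : c ^ 2 + ⟪w, w⟫ = 1 := by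
    have h : ⟪φN, φN⟫ = 1 := by rw [real_inner_self_eq_norm_sq, hφNnorm]; norm_num
    rw [hdecomp] at h
    simp only [inner_add_left, inner_add_right, real_inner_smul_left, real_inner_smul_right,
      hφφ, hwφ, hφw] at h
    linarith
  have hRayleigh : lamN = c ^ 2 * lam + ⟪w, A w⟫ := by
    rw [hlamN, hdecomp]
    simp only [map_add, map_smul, hφ, inner_add_left, inner_add_right, real_inner_smul_left,
      real_inner_smul_right, hφφ, hwφ, hφAw]
    ring
  have henergy : lamN - lam ≤ ⟪w, A w⟫ := by
    have h : 0 ≤ lam * ⟪w, w⟫ := mul_nonneg hlam_nonneg real_inner_self_nonneg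
    linear_combination h + hRayleigh + lam * hnorm
  have hResidual : ⟪A w - lamN • w, B (A w - lamN • w)⟫ ≤ ⟪Res, B Res⟫ := by
    set r := A w - lamN • w with hr
    have hφr : ⟪φ, r⟫ = 0 := by
      rw [hr, inner_sub_right, real_inner_smul_right, hφAw, hφw]; ring
    have hφBr : ⟪φ, B r⟫ = 0 := by
      rw [hr, map_sub, map_smul, hBA, inner_sub_right, real_inner_smul_right, hφw, hφBw]; ring
    have hsplit : Res = (c * (lamN - lam)) • φ - r := by
      rw [hRes, hdecomp, hr, map_add, map_smul, hφ]
      module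
    have hexpand : ⟪Res, B Res⟫ = (c * (lamN - lam)) ^ 2 * lam⁻¹ + ⟪r, B r⟫ := by
      rw [hsplit]
      simp only [map_sub, map_smul, hBφ, inner_sub_left, inner_sub_right, real_inner_smul_left,
        real_inner_smul_right, hφφ, hφBr, real_inner_comm φ r, hφr]
      ring
    rw [hexpand]
    exact le_add_of_nonneg_left (by positivity)
  calc lamN - lam ≤ ⟪w, A w⟫ := henergy
    _ ≤ γ⁻¹ * ⟪Res, B Res⟫ := by
      rw [le_inv_mul_iff₀ hγ]
      exact (hgap1 w hwφ).trans hResidual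
end

section
/- Assume in addition ⟨φ, φ_N⟩ ≥ 0, and set r² := Σ_{k=1}^{K+1} ‖T_k Res‖_{A_k⁻¹}² (the sum of the localized dual norms of the residual). Then the energy-norm eigenvector error satisfies ‖φ − φ_N‖_A ≤ ( C γ⁻¹ r² + λ C² γ̂⁻² r⁴ )^{1/2}. (This is the eigenvector bound (3.10) of Theorem 3.2 of the paper.) -/
open scoped RealInnerProductSpace

/-- If a linear stable splitting with constant `C` is given, the global dual energy of `x` is at
most `C` times the sum of the localized dual energies. -/
theorem dual_energy_le_sum_localized {ι : Type*} [Fintype ι]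
    {H : Type*} [NormedAddCommGroup H] [InnerProductSpace ℝ H]
    {Hk : ι → Type*} [∀ k, NormedAddCommGroup (Hk k)] [∀ k, InnerProductSpace ℝ (Hk k)]
    (A B : H →L[ℝ] H) (hAB : ∀ v, A (B v) = v)
    (Ak Bk : ∀ k, Hk k →L[ℝ] Hk k)
    (hAksym : ∀ k, ∀ v w : Hk k, ⟪Ak k v, w⟫ = ⟪v, Ak k w⟫)
    (hAkpos : ∀ k, ∀ w : Hk k, 0 ≤ ⟪w, Ak k w⟫)
    (hAkBk : ∀ k, ∀ v : Hk k, Ak k (Bk k v) = v)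
    (T : ∀ k, H →L[ℝ] Hk k)
    (hT : ∀ v w : H, ⟪v, w⟫ = ∑ k, ⟪T k v, T k w⟫)
    {C : ℝ} (hC : 0 < C)
    (hCbound : ∀ w : H, ∑ k, ⟪T k w, Ak k (T k w)⟫ ≤ C * ⟪w, A w⟫) (x : H) :
    ⟪x, B x⟫ ≤ C * ∑ k, ⟪T k x, Bk k (T k x)⟫ := by
  have expand : ∀ k, ⟪C • Bk k (T k x) - T k (B x), Ak k (C • Bk k (T k x) - T k (B x))⟫
      = C ^ 2 * ⟪T k x, Bk k (T k x)⟫ - 2 * C * ⟪T k x, T k (B x)⟫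
        + ⟪T k (B x), Ak k (T k (B x))⟫ := by
    intro k
    have h : ⟪Bk k (T k x), Ak k (T k (B x))⟫ = ⟪T k x, T k (B x)⟫ := by
      rw [← hAksym, hAkBk]
    simp only [map_sub, map_smul, hAkBk, inner_sub_left, inner_sub_right, real_inner_smul_left,
      real_inner_smul_right, h]
    rw [real_inner_comm (T k x) (T k (B x)), real_inner_comm (T k x) (Bk k (T k x))]
    ring
  have nonneg := Finset.sum_nonneg fun k (_ : k ∈ Finset.univ) =>
    hAkpos k (C • Bk k (T k x) - T k (B x))
  simp only [expand, Finset.sum_add_distrib, Finset.sum_sub_distrib, ← Finset.mul_sum,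
    ← hT] at nonneg
  have bound := hCbound (B x)
  rw [hAB, real_inner_comm x (B x)] at bound
  refine le_of_mul_le_mul_left ?_ hC
  linarith

/-- Removing the component along an eigenvector from `v` does not increase the dual energy of the
residual `A v - μ • v`. -/
theorem dual_energy_residual_orthogonal_le
    {H : Type*} [NormedAddCommGroup H] [InnerProductSpace ℝ H]
    (A B : H →L[ℝ] H)
    (hAsym : ∀ v w : H, ⟪A v, w⟫ = ⟪v, A w⟫)
    (hApos : ∀ w : H, 0 ≤ ⟪w, A w⟫)
    (hAB : ∀ v, A (B v) = v) (hBA : ∀ v, B (A v) = v)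
    {lam : ℝ} {φ : H} (hφ : A φ = lam • φ) (hφ0 : φ ≠ 0)
    (μ c : ℝ) (v : H) (horth : ⟪v - c • φ, φ⟫ = 0) :
    ⟪A (v - c • φ) - μ • (v - c • φ), B (A (v - c • φ) - μ • (v - c • φ))⟫
      ≤ ⟪μ • v - A v, B (μ • v - A v)⟫ := by
  set w := v - c • φ with hw
  set g := A w - μ • w with hg
  have hlamB : lam • B φ = φ := by rw [← map_smul, ← hφ, hBA]
  have hlam : lam ≠ 0 := by
    rintro rfl
    exact hφ0 (by simpa using hlamB.symm)
  have hgφ : ⟪g, φ⟫ = 0 := by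
    rw [hg, inner_sub_left, hAsym, hφ, real_inner_smul_right, real_inner_smul_left, horth]
    simp
  have hgB : ⟪g, B φ⟫ = 0 := by
    rw [← hlamB, real_inner_smul_right] at hgφ
    exact (mul_eq_zero.mp hgφ).resolve_left hlam
  have hBg : ⟪φ, B g⟫ = 0 := by
    calc ⟪φ, B g⟫ = ⟪A (B φ), B g⟫ := by rw [hAB]
      _ = 0 := by rw [hAsym, hAB, real_inner_comm, hgB]
  have hBφ : 0 ≤ ⟪φ, B φ⟫ := by
    have := hApos (B φ)
    rwa [hAB, real_inner_comm] at this
  have hres : μ • v - A v = (c * (μ - lam)) • φ - g := by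
    rw [hg, hw, map_sub, map_smul, hφ]
    module
  rw [hres]
  simp only [map_sub, map_smul, inner_sub_left, inner_sub_right, real_inner_smul_left,
    real_inner_smul_right, hgB, hBg]
  nlinarith [mul_nonneg (sq_nonneg (c * (μ - lam))) hBφ]

/-- Theorem 3.2, bound (3.10): ‖φ − φ_N‖_A ≤ (C γ⁻¹ r² + λ C² γ̂⁻² r⁴)^{1/2},
where r² = ∑_{k=1}^{K+1} ‖T_k Res‖_{A_k⁻¹}². -/
theorem eigenvector_localized_energy_estimate
    {H : Type*} [NormedAddCommGroup H] [InnerProductSpace ℝ H] [CompleteSpace H]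
    {K : ℕ} (hK : 1 ≤ K)
    {Hk : Fin (K + 1) → Type*} [∀ k, NormedAddCommGroup (Hk k)]
    [∀ k, InnerProductSpace ℝ (Hk k)] [∀ k, CompleteSpace (Hk k)]
    (A B : H →L[ℝ] H)
    (hAsym : ∀ v w : H, ⟪A v, w⟫ = ⟪v, A w⟫)
    (hApos : ∀ w : H, 0 ≤ ⟪w, A w⟫)
    (hAB : ∀ v, A (B v) = v) (hBA : ∀ v, B (A v) = v)
    (Ak Bk : ∀ k, Hk k →L[ℝ] Hk k)
    (hAksym : ∀ k, ∀ v w : Hk k, ⟪Ak k v, w⟫ = ⟪v, Ak k w⟫)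
    (hAkpos : ∀ k, ∀ w : Hk k, 0 ≤ ⟪w, Ak k w⟫)
    (hAkBk : ∀ k, ∀ v : Hk k, Ak k (Bk k v) = v)
    (hBkAk : ∀ k, ∀ v : Hk k, Bk k (Ak k v) = v)
    (T : ∀ k, H →L[ℝ] Hk k)
    (hT : ∀ v w : H, ⟪v, w⟫ = ∑ k, ⟪T k v, T k w⟫)
    (C : ℝ) (hC : 0 < C)
    (hCbound : ∀ w : H, ∑ k, ⟪T k w, Ak k (T k w)⟫ ≤ C * ⟪w, A w⟫)
    (lam : ℝ) (φ : H) (hφ : A φ = lam • φ) (hφnorm : ‖φ‖ = 1)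
    (lamN : ℝ) (φN : H) (hφNnorm : ‖φN‖ = 1)
    (Res : H) (hRes : Res = lamN • φN - A φN)
    (γ γhat : ℝ) (hγ : 0 < γ) (hγhat : 0 < γhat)
    (hgap1 : ∀ w : H, ⟪w, φ⟫ = 0 →
      γ * ⟪w, A w⟫ ≤ ⟪A w - lamN • w, B (A w - lamN • w)⟫)
    (hgap2 : ∀ w : H, ⟪w, φ⟫ = 0 →
      γhat * ‖w‖ ^ 2 ≤ ⟪A w - lamN • w, B (A w - lamN • w)⟫)
    (hposip : 0 ≤ ⟪φ, φN⟫)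
    (r2 : ℝ) (hr2 : r2 = ∑ k, ⟪T k Res, Bk k (T k Res)⟫) :
    Real.sqrt ⟪φ - φN, A (φ - φN)⟫ ≤
      Real.sqrt (C * γ⁻¹ * r2 + lam * C ^ 2 * (γhat ^ 2)⁻¹ * r2 ^ 2) := by
  have hdual : ⟪Res, B Res⟫ ≤ C * r2 := hr2 ▸
    dual_energy_le_sum_localized A B hAB Ak Bk hAksym hAkpos hAkBk T hT hC hCbound Res
  have hφφ : ⟪φ, φ⟫ = 1 := by rw [real_inner_self_eq_norm_sq, hφnorm, one_pow]
  have hφ0 : φ ≠ 0 := norm_ne_zero_iff.mp (hφnorm ▸ one_ne_zero)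
  have hlam : 0 ≤ lam := by
    have := hApos φ
    rwa [hφ, real_inner_smul_right, hφφ, mul_one] at this
  set c := ⟪φ, φN⟫ with hc
  have hc1 : c ≤ 1 := by
    have := real_inner_le_norm φ φN
    rwa [hφnorm, hφNnorm, mul_one] at this
  set w := φN - c • φ with hw
  have horth : ⟪w, φ⟫ = 0 := by
    rw [hw, inner_sub_left, real_inner_smul_left, hφφ, real_inner_comm, ← hc]
    ring
  have hwnorm : ‖w‖ ^ 2 = 1 - c ^ 2 := by
    rw [← real_inner_self_eq_norm_sq]
    nth_rw 2 [hw]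
    rw [inner_sub_right, real_inner_smul_right, horth, hw, inner_sub_left, real_inner_smul_left,
      ← hc, real_inner_self_eq_norm_sq, hφNnorm]
    ring
  have hres := (hRes ▸ dual_energy_residual_orthogonal_le A B hAsym hApos hAB hBA hφ hφ0 lamN c φN
    horth).trans hdual
  have hwA : ⟪w, A w⟫ ≤ C * γ⁻¹ * r2 := by
    have := (hgap1 w horth).trans hres
    rw [mul_right_comm, ← div_eq_mul_inv, le_div_iff₀ hγ]
    linarith
  have hw2 : 1 - c ^ 2 ≤ C * r2 / γhat := by
    have := (hgap2 w horth).trans hres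
    rw [hwnorm] at this
    rw [le_div_iff₀ hγhat]
    linarith
  have herr : ⟪φ - φN, A (φ - φN)⟫ = ⟪w, A w⟫ + lam * (1 - c) ^ 2 := by
    have hsplit : φ - φN = (1 - c) • φ - w := by
      rw [hw]
      module
    have hcross : ⟪φ, A w⟫ = 0 := by
      rw [← hAsym, hφ, real_inner_smul_left, real_inner_comm, horth, mul_zero]
    rw [hsplit]
    simp only [map_sub, map_smul, hφ, inner_sub_left, inner_sub_right, real_inner_smul_left,
      real_inner_smul_right, hcross, horth, hφφ]
    ring
  have hsq : (1 - c) ^ 2 ≤ (C * r2 / γhat) ^ 2 :=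
    pow_le_pow_left₀ (by linarith) (by nlinarith) 2
  apply Real.sqrt_le_sqrt
  calc ⟪φ - φN, A (φ - φN)⟫ = ⟪w, A w⟫ + lam * (1 - c) ^ 2 := herr
    _ ≤ C * γ⁻¹ * r2 + lam * (C * r2 / γhat) ^ 2 := by gcongr
    _ = C * γ⁻¹ * r2 + lam * C ^ 2 * (γhat ^ 2)⁻¹ * r2 ^ 2 := by ring
end

section
/- Assume in addition λ_N = ⟨φ_N, A φ_N⟩, and set r² := Σ_{k=1}^{K+1} ‖T_k Res‖_{A_k⁻¹}² (the sum of the localized dual norms of the residual). Then the eigenvalue error satisfies λ_N − λ ≤ C γ⁻¹ r². (This is the eigenvalue bound (3.11) of Theorem 3.2 of the paper.) -/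
open scoped RealInnerProductSpace

/-- Weighted Young inequality for a positive symmetric operator `A` with right inverse `B`. -/
theorem young_energy_dual {E : Type*} [NormedAddCommGroup E] [InnerProductSpace ℝ E]
    (A B : E →L[ℝ] E) (hAsym : ∀ v w : E, ⟪A v, w⟫ = ⟪v, A w⟫)
    (hApos : ∀ w : E, 0 ≤ ⟪w, A w⟫) (hAB : ∀ v, A (B v) = v) (c : ℝ) (x y : E) :
    2 * c * ⟪x, y⟫ ≤ c ^ 2 * ⟪x, B x⟫ + ⟪y, A y⟫ := by
  have h := hApos (y - c • B x)
  have h1 : ⟪B x, A y⟫ = ⟪x, y⟫ := by rw [← hAsym, hAB]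
  simp only [map_sub, map_smul, hAB, inner_sub_left, inner_sub_right, real_inner_smul_left,
    real_inner_smul_right, h1, real_inner_comm x y, real_inner_comm x (B x)] at h
  linarith [real_inner_comm x y, real_inner_comm x (B x)]

/-- The dual norm is controlled by the sum of the localized dual norms. -/
theorem dual_norm_sq_le_localized {H : Type*} [NormedAddCommGroup H] [InnerProductSpace ℝ H]
    {ι : Type*} [Fintype ι] {Hk : ι → Type*} [∀ k, NormedAddCommGroup (Hk k)]
    [∀ k, InnerProductSpace ℝ (Hk k)] (A B : H →L[ℝ] H) (hAB : ∀ v, A (B v) = v)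
    (Ak Bk : ∀ k, Hk k →L[ℝ] Hk k)
    (hAksym : ∀ k, ∀ v w : Hk k, ⟪Ak k v, w⟫ = ⟪v, Ak k w⟫)
    (hAkpos : ∀ k, ∀ w : Hk k, 0 ≤ ⟪w, Ak k w⟫)
    (hAkBk : ∀ k, ∀ v : Hk k, Ak k (Bk k v) = v)
    (T : ∀ k, H →L[ℝ] Hk k) (hT : ∀ v w : H, ⟪v, w⟫ = ∑ k, ⟪T k v, T k w⟫)
    {C : ℝ} (hC : 0 < C)
    (hCbound : ∀ w : H, ∑ k, ⟪T k w, Ak k (T k w)⟫ ≤ C * ⟪w, A w⟫) (v : H) :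
    ⟪v, B v⟫ ≤ C * ∑ k, ⟪T k v, Bk k (T k v)⟫ := by
  have hsum := Finset.sum_le_sum fun k (_ : k ∈ Finset.univ) =>
    young_energy_dual (Ak k) (Bk k) (hAksym k) (hAkpos k) (hAkBk k) C (T k v) (T k (B v))
  rw [Finset.sum_add_distrib, ← Finset.mul_sum, ← Finset.mul_sum, ← hT] at hsum
  have hb := hCbound (B v)
  rw [hAB, real_inner_comm] at hb
  refine le_of_mul_le_mul_left ?_ hC
  linarith

/-- For an eigenpair `(lam, φ)`, the part of a unit vector `u` orthogonal to `φ` bounds the excess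
of the Rayleigh quotient of `u` over `lam`. -/
theorem rayleigh_sub_eigenvalue_le {H : Type*} [NormedAddCommGroup H] [InnerProductSpace ℝ H]
    (A : H →L[ℝ] H) (hAsym : ∀ v w : H, ⟪A v, w⟫ = ⟪v, A w⟫) {lam : ℝ} (hlam : 0 ≤ lam)
    {φ w : H} (hφ : A φ = lam • φ) (hφnorm : ‖φ‖ = 1) (hw : ⟪w, φ⟫ = 0) {c : ℝ}
    (hnorm : ‖c • φ + w‖ = 1) :
    ⟪c • φ + w, A (c • φ + w)⟫ - lam ≤ ⟪w, A w⟫ := by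
  have hw' : ⟪φ, w⟫ = 0 := by rw [real_inner_comm, hw]
  have hAw : ⟪φ, A w⟫ = 0 := by rw [← hAsym, hφ, real_inner_smul_left, hw', mul_zero]
  have hφφ : ⟪φ, φ⟫ = 1 := by rw [real_inner_self_eq_norm_sq, hφnorm, one_pow]
  have hone : ⟪c • φ + w, c • φ + w⟫ = 1 := by rw [real_inner_self_eq_norm_sq, hnorm, one_pow]
  simp only [map_add, map_smul, hφ, inner_add_left, inner_add_right, real_inner_smul_left,
    real_inner_smul_right, hw, hw', hAw, hφφ] at hone ⊢
  nlinarith [mul_nonneg hlam (real_inner_self_nonneg (x := w))]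

/-- The dual norm of the residual of `c • φ + w` dominates that of its component orthogonal to the
eigenvector `φ`. -/
theorem dual_norm_sq_orthogonal_residual_le {H : Type*} [NormedAddCommGroup H]
    [InnerProductSpace ℝ H] (A B : H →L[ℝ] H)
    (hAsym : ∀ v w : H, ⟪A v, w⟫ = ⟪v, A w⟫) (hAB : ∀ v, A (B v) = v)
    (hBA : ∀ v, B (A v) = v) {lam : ℝ} (hlam : 0 < lam) {φ w : H} (hφ : A φ = lam • φ)
    (hw : ⟪w, φ⟫ = 0) (c μ : ℝ) :
    ⟪A w - μ • w, B (A w - μ • w)⟫ ≤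
      ⟪μ • (c • φ + w) - A (c • φ + w), B (μ • (c • φ + w) - A (c • φ + w))⟫ := by
  have hw' : ⟪φ, w⟫ = 0 := by rw [real_inner_comm, hw]
  have hBφ : B φ = lam⁻¹ • φ := by
    rw [eq_inv_smul_iff₀ hlam.ne', ← map_smul, ← hφ, hBA]
  have hAw : ⟪A w, φ⟫ = 0 := by rw [hAsym, hφ, real_inner_smul_right, hw, mul_zero]
  have hBw : ⟪φ, B w⟫ = 0 := by
    have h := hAsym φ (B w)
    rw [hAB, hφ, hw', real_inner_smul_left] at h
    exact (mul_eq_zero.mp h).resolve_left hlam.ne'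
  have hdecomp : μ • (c • φ + w) - A (c • φ + w) =
      (c * (μ - lam)) • φ - (A w - μ • w) := by
    rw [map_add, map_smul, hφ]
    module
  rw [hdecomp]
  generalize c * (μ - lam) = a
  have hcross : ⟪φ, B (A w - μ • w)⟫ = 0 := by
    rw [map_sub, map_smul, hBA, inner_sub_right, real_inner_smul_right, hw', hBw]
    ring
  have hcross' : ⟪A w - μ • w, φ⟫ = 0 := by
    rw [inner_sub_left, real_inner_smul_left, hAw, hw]
    ring
  rw [map_sub B (a • φ), map_smul B a, hBφ]
  generalize B (A w - μ • w) = z at *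
  simp only [inner_sub_left (a • φ), inner_sub_right, real_inner_smul_left,
    real_inner_smul_right, hcross, hcross']
  have : 0 ≤ a * (a * (lam⁻¹ * ⟪φ, φ⟫)) := by
    rw [← mul_assoc]
    exact mul_nonneg (mul_self_nonneg a)
      (mul_nonneg (inv_nonneg.mpr hlam.le) real_inner_self_nonneg)
  linarith

/-- Theorem 3.2, bound (3.11): λ_N − λ ≤ C γ⁻¹ r²,
where r² = ∑_{k=1}^{K+1} ‖T_k Res‖_{A_k⁻¹}² and λ_N = ⟨φ_N, A φ_N⟩. -/
theorem eigenvalue_localized_estimate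
    {H : Type*} [NormedAddCommGroup H] [InnerProductSpace ℝ H] [CompleteSpace H]
    {K : ℕ} (hK : 1 ≤ K)
    {Hk : Fin (K + 1) → Type*} [∀ k, NormedAddCommGroup (Hk k)]
    [∀ k, InnerProductSpace ℝ (Hk k)] [∀ k, CompleteSpace (Hk k)]
    (A B : H →L[ℝ] H)
    (hAsym : ∀ v w : H, ⟪A v, w⟫ = ⟪v, A w⟫)
    (hApos : ∀ w : H, 0 ≤ ⟪w, A w⟫)
    (hAB : ∀ v, A (B v) = v) (hBA : ∀ v, B (A v) = v)
    (Ak Bk : ∀ k, Hk k →L[ℝ] Hk k)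
    (hAksym : ∀ k, ∀ v w : Hk k, ⟪Ak k v, w⟫ = ⟪v, Ak k w⟫)
    (hAkpos : ∀ k, ∀ w : Hk k, 0 ≤ ⟪w, Ak k w⟫)
    (hAkBk : ∀ k, ∀ v : Hk k, Ak k (Bk k v) = v)
    (hBkAk : ∀ k, ∀ v : Hk k, Bk k (Ak k v) = v)
    (T : ∀ k, H →L[ℝ] Hk k)
    (hT : ∀ v w : H, ⟪v, w⟫ = ∑ k, ⟪T k v, T k w⟫)
    (C : ℝ) (hC : 0 < C)
    (hCbound : ∀ w : H, ∑ k, ⟪T k w, Ak k (T k w)⟫ ≤ C * ⟪w, A w⟫)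
    (lam : ℝ) (φ : H) (hφ : A φ = lam • φ) (hφnorm : ‖φ‖ = 1)
    (lamN : ℝ) (φN : H) (hφNnorm : ‖φN‖ = 1)
    (Res : H) (hRes : Res = lamN • φN - A φN)
    (γ γhat : ℝ) (hγ : 0 < γ) (hγhat : 0 < γhat)
    (hgap1 : ∀ w : H, ⟪w, φ⟫ = 0 →
      γ * ⟪w, A w⟫ ≤ ⟪A w - lamN • w, B (A w - lamN • w)⟫)
    (hgap2 : ∀ w : H, ⟪w, φ⟫ = 0 →
      γhat * ‖w‖ ^ 2 ≤ ⟪A w - lamN • w, B (A w - lamN • w)⟫)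
    (hlamN : lamN = ⟪φN, A φN⟫)
    (r2 : ℝ) (hr2 : r2 = ∑ k, ⟪T k Res, Bk k (T k Res)⟫) :
    lamN - lam ≤ C * γ⁻¹ * r2 := by
  have hφφ : ⟪φ, φ⟫ = 1 := by rw [real_inner_self_eq_norm_sq, hφnorm, one_pow]
  have hlam : 0 < lam := by
    refine lt_of_le_of_ne ?_ fun h0 => ?_
    · simpa only [hφ, real_inner_smul_right, hφφ, mul_one] using hApos φ
    · have hzero := hBA φ
      rw [hφ, ← h0, zero_smul, map_zero] at hzero
      simp [← hzero] at hφnorm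
  obtain ⟨c, w, hw, rfl⟩ : ∃ (c : ℝ) (w : H), ⟪w, φ⟫ = 0 ∧ φN = c • φ + w := by
    refine ⟨⟪φN, φ⟫, φN - ⟪φN, φ⟫ • φ, ?_, by abel⟩
    rw [inner_sub_left, real_inner_smul_left, hφφ, mul_one, sub_self]
  have henergy : lamN - lam ≤ ⟪w, A w⟫ := by
    rw [hlamN]
    exact rayleigh_sub_eigenvalue_le A hAsym hlam.le hφ hφnorm hw hφNnorm
  have hres := dual_norm_sq_orthogonal_residual_le A B hAsym hAB hBA hlam hφ hw c lamN
  rw [← hRes] at hres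
  have hloc := dual_norm_sq_le_localized A B hAB Ak Bk hAksym hAkpos hAkBk T hT hC hCbound Res
  rw [← hr2] at hloc
  calc lamN - lam ≤ ⟪w, A w⟫ := henergy
    _ ≤ γ⁻¹ * (C * r2) :=
      (le_inv_mul_iff₀ hγ).mpr (((hgap1 w hw).trans hres).trans hloc)
    _ = C * γ⁻¹ * r2 := by ring
end

section
/- Let d ≥ 1 and work on EuclideanSpace ℝ (Fin d) with Lebesgue measure. Let p : ℝ^d → ℝ be twice continuously differentiable with p(x) > 0 for every x, and let v : ℝ^d → ℝ be twice continuously differentiable with compact support. Then ∫ ‖∇(√p · v)(x)‖² dx = ∫ p(x) ‖∇v(x)‖² dx − (1/2) ∫ (Δp)(x) v(x)² dx + ∫ ( ‖∇p(x)‖² / (4 p(x)) ) v(x)² dx. (This is the integral identity (5.2) in the proof of Lemma 5.1 of the paper, obtained by expanding the gradient and integrating by parts.) -/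
open scoped RealInnerProductSpace

/-- The Laplacian of `p : ℝ^d → ℝ`, i.e. the sum of the second partial
derivatives `∂²p/∂x_i²` in the coordinate directions. -/
noncomputable def euclideanLaplacian {d : ℕ} (p : EuclideanSpace ℝ (Fin d) → ℝ)
    (x : EuclideanSpace ℝ (Fin d)) : ℝ :=
  ∑ i, fderiv ℝ (fun y => fderiv ℝ p y (EuclideanSpace.single i 1)) x
    (EuclideanSpace.single i 1)

open MeasureTheory

lemma norm_gradient_sq_eq_sum_fderiv {d : ℕ} (f : EuclideanSpace ℝ (Fin d) → ℝ)
    (x : EuclideanSpace ℝ (Fin d)) :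
    ‖gradient f x‖ ^ 2 = ∑ i, fderiv ℝ f x (EuclideanSpace.single i 1) ^ 2 := by
  rw [EuclideanSpace.real_norm_sq_eq]
  refine Finset.sum_congr rfl fun i _ => ?_
  rw [← toDual_gradient (𝕜 := ℝ), InnerProductSpace.toDual_apply_apply,
    EuclideanSpace.inner_single_right]
  simp

/-- The first Green identity on `ℝ^d` for a compactly supported test function. -/
lemma integral_euclideanLaplacian_mul {d : ℕ} {p w : EuclideanSpace ℝ (Fin d) → ℝ}
    (hp : ContDiff ℝ 2 p) (hw : ContDiff ℝ 1 w) (hwsupp : HasCompactSupport w) :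
    ∫ x, euclideanLaplacian p x * w x =
      -∫ x, ∑ i, fderiv ℝ p x (EuclideanSpace.single i 1) *
        fderiv ℝ w x (EuclideanSpace.single i 1) := by
  have hp' (u : EuclideanSpace ℝ (Fin d)) : ContDiff ℝ 1 (fun y => fderiv ℝ p y u) :=
    (hp.fderiv_right (by norm_num)).clm_apply contDiff_const
  have hp'' (u : EuclideanSpace ℝ (Fin d)) :
      Continuous (fun x => fderiv ℝ (fun y => fderiv ℝ p y u) x u) :=
    ((hp' u).continuous_fderiv one_ne_zero).clm_apply continuous_const
  have hw' (u : EuclideanSpace ℝ (Fin d)) : Continuous (fun x => fderiv ℝ w x u) :=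
    (hw.continuous_fderiv one_ne_zero).clm_apply continuous_const
  have hleft (u : EuclideanSpace ℝ (Fin d)) :
      Integrable (fun x => fderiv ℝ (fun y => fderiv ℝ p y u) x u * w x) :=
    ((hp'' u).mul hw.continuous).integrable_of_hasCompactSupport hwsupp.mul_left
  have hright (u : EuclideanSpace ℝ (Fin d)) :
      Integrable (fun x => fderiv ℝ p x u * fderiv ℝ w x u) :=
    ((hp' u).continuous.mul (hw' u)).integrable_of_hasCompactSupport
      (hwsupp.fderiv_apply ℝ u).mul_left
  simp only [euclideanLaplacian, Finset.sum_mul]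
  rw [integral_finsetSum _ fun i _ => hleft _, integral_finsetSum _ fun i _ => hright _,
    ← Finset.sum_neg_distrib]
  refine Finset.sum_congr rfl fun i _ => ?_
  rw [integral_mul_fderiv_eq_neg_fderiv_mul_of_integrable (hleft _) (hright _)
    (((hp' _).continuous.mul hw.continuous).integrable_of_hasCompactSupport hwsupp.mul_left)
    (fun x _ => (hp' _).differentiable one_ne_zero x)
    (fun x _ => hw.differentiable one_ne_zero x), neg_neg]

lemma norm_gradient_sqrt_mul_sq {d : ℕ} {p v : EuclideanSpace ℝ (Fin d) → ℝ}
    {x : EuclideanSpace ℝ (Fin d)} (hp : DifferentiableAt ℝ p x) (hpos : 0 < p x)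
    (hv : DifferentiableAt ℝ v x) :
    ‖gradient (fun y => Real.sqrt (p y) * v y) x‖ ^ 2 =
      p x * ‖gradient v x‖ ^ 2
        + (1 / 2) * ∑ i, fderiv ℝ p x (EuclideanSpace.single i 1) *
          fderiv ℝ (fun y => v y ^ 2) x (EuclideanSpace.single i 1)
        + ‖gradient p x‖ ^ 2 / (4 * p x) * v x ^ 2 := by
  simp only [norm_gradient_sq_eq_sum_fderiv, Finset.mul_sum, Finset.sum_mul, Finset.sum_div,
    ← Finset.sum_add_distrib]
  refine Finset.sum_congr rfl fun i _ => ?_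
  rw [((hp.hasFDerivAt.sqrt hpos.ne').fun_mul hv.hasFDerivAt).fderiv, (hv.hasFDerivAt.pow 2).fderiv]
  have hs : Real.sqrt (p x) ≠ 0 := (Real.sqrt_pos.2 hpos).ne'
  rw [← Real.sq_sqrt hpos.le]
  simp only [add_apply, smul_apply, smul_eq_mul,
    Real.sqrt_sq (Real.sqrt_nonneg (p x)), nsmul_eq_mul]
  field_simp
  ring

/-- Integral identity (5.2) in the proof of Lemma 5.1:
`∫ |∇(√p v)|² = ∫ p |∇v|² − ½ ∫ (Δp) v² + ∫ |∇p|²/(4p) v²`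
for `p` twice continuously differentiable and positive, and `v` twice
continuously differentiable with compact support. -/
theorem integral_gradient_sqrt_mul_sq
    {d : ℕ} (hd : 1 ≤ d)
    (p v : EuclideanSpace ℝ (Fin d) → ℝ)
    (hp : ContDiff ℝ 2 p) (hppos : ∀ x, 0 < p x)
    (hv : ContDiff ℝ 2 v) (hvsupp : HasCompactSupport v) :
    ∫ x, ‖gradient (fun y => Real.sqrt (p y) * v y) x‖ ^ 2 =
      (∫ x, p x * ‖gradient v x‖ ^ 2)
        - (1 / 2) * (∫ x, euclideanLaplacian p x * v x ^ 2)
        + ∫ x, (‖gradient p x‖ ^ 2 / (4 * p x)) * v x ^ 2 := by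
  have hw : ContDiff ℝ 1 (fun y => v y ^ 2) := (hv.of_le (by norm_num)).pow 2
  have hwsupp : HasCompactSupport (fun y => v y ^ 2) :=
    hvsupp.comp_left (g := fun t : ℝ => t ^ 2) (by norm_num)
  have hgrad {f : EuclideanSpace ℝ (Fin d) → ℝ} (hf : ContDiff ℝ 2 f) :
      Continuous (gradient f) :=
    (InnerProductSpace.toDual ℝ _).symm.continuous.comp (hf.continuous_fderiv two_ne_zero)
  have hdirichlet : Integrable (fun x => p x * ‖gradient v x‖ ^ 2) := by
    refine (hp.continuous.mul ((hgrad hv).norm.pow 2)).integrable_of_hasCompactSupport ?_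
    refine ((hvsupp.fderiv ℝ).mono fun x hx => ?_).mul_left
    contrapose! hx
    simp_all [gradient]
  have hcross : Integrable (fun x => (1 / 2) * ∑ i, fderiv ℝ p x (EuclideanSpace.single i 1) *
      fderiv ℝ (fun y => v y ^ 2) x (EuclideanSpace.single i 1)) := by
    refine (integrable_finsetSum _ fun i _ => ?_).const_mul _
    exact (((hp.continuous_fderiv two_ne_zero).clm_apply continuous_const).mul
      ((hw.continuous_fderiv one_ne_zero).clm_apply
        continuous_const)).integrable_of_hasCompactSupport (hwsupp.fderiv_apply ℝ _).mul_left
  have hpotential : Integrable (fun x => ‖gradient p x‖ ^ 2 / (4 * p x) * v x ^ 2) :=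
    ((((hgrad hp).norm.pow 2).div (continuous_const.mul hp.continuous)
      fun x => (mul_pos four_pos (hppos x)).ne').mul
        hw.continuous).integrable_of_hasCompactSupport hwsupp.mul_left
  simp_rw [norm_gradient_sqrt_mul_sq (hp.differentiable two_ne_zero _) (hppos _)
    (hv.differentiable two_ne_zero _)]
  rw [integral_add (hdirichlet.fun_add hcross) hpotential, integral_add hdirichlet hcross,
    integral_const_mul, integral_euclideanLaplacian_mul hp hw hwsupp]
  ring
end
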